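/- arXiv:2603.26620 — 2 statements merged into one kernel-verified Lean document; each statement's English description precedes it below -/
import Mathlib

section
/- For each event ℓ = 1,…,m let (c_ℓ, s_ℓ) be a feasible one-event strategy with c_ℓ > 0, wealth factor F_ℓ(i) = c_ℓ + s_{ℓi}/π_{ℓi}, and let x*_γ := ∏_{ℓ: γ_ℓ = 0} c_ℓ · ∏_{ℓ: γ_ℓ ≠ 0} s_{ℓ,γ_ℓ}. Let I = (I_1,…,I_m) be random with independent coordinates and P(I_ℓ = i) = p_{ℓi}. Then for every ticket γ, E[1_{γ ≼ I} / (π_γ W_{x*}(I))] = ∏_{ℓ: γ_ℓ ≠ 0} p_{ℓ,γ_ℓ}/(π_{ℓ,γ_ℓ} F_ℓ(γ_ℓ)) · ∏_{ℓ: γ_ℓ = 0} E[1/F_ℓ(I_ℓ)]. -/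
open Finset

/-- The sum over all tickets compatible with an outcome vector `I` of a product of one-event
weights is the product of the one-event sums. -/
theorem sum_filter_compatible_prod {ι R : Type*} [Fintype ι] [DecidableEq ι] [CommSemiring R]
    {α : ι → Type*} [∀ l, Fintype (α l)] (I : ∀ l, α l)
    [DecidablePred fun γ : ∀ l, Option (α l) => ∀ l, γ l = none ∨ γ l = some (I l)]
    (f : ∀ l, Option (α l) → R) :
    ∑ γ ∈ univ.filter (fun γ : ∀ l, Option (α l) => ∀ l, γ l = none ∨ γ l = some (I l)),
        ∏ l, f l (γ l) = ∏ l, (f l none + f l (some (I l))) := by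
  classical
  have hset : univ.filter (fun γ : ∀ l, Option (α l) => ∀ l, γ l = none ∨ γ l = some (I l))
      = Fintype.piFinset fun l => {none, some (I l)} := by
    ext γ
    simp [Fintype.mem_piFinset]
  rw [hset, ← prod_univ_sum]
  exact prod_congr rfl fun l _ => sum_pair (by simp)

/-- There are `m` betting events; event `ℓ` has outcomes `Fin (n ℓ)` with probabilities
`p ℓ i > 0` summing to 1 and state prices `π ℓ i > 0`.  A ticket `γ` has `γ ℓ : Option (Fin (n ℓ))`
(`none` = event omitted), price `πt γ = ∏ ℓ, (γ ℓ).elim 1 (π ℓ)`, and `γ ≼ I` means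
`γ ℓ ∈ {none, some (I ℓ)}` for every `ℓ`.  A ticket book `x` pays `W x I = ∑_{γ ≼ I} x γ / πt γ`.
The random outcome vector `I` has independent coordinates with `P (I ℓ = i) = p ℓ i`, so the
expectation of `f I` is `∑ I, (∏ ℓ, p ℓ (I ℓ)) * f I`.

STATEMENT 6: for feasible one-event strategies `(c ℓ, s ℓ)` with `c ℓ > 0`, wealth factors
`F ℓ i = c ℓ + s ℓ i / π ℓ i`, and product ticket book `x γ = ∏ ℓ, (γ ℓ).elim (c ℓ) (s ℓ)`,
one has, for every ticket `γ`,
`E[1_{γ ≼ I} / (πt γ * W x I)]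
   = ∏_{ℓ : γ ℓ ≠ none} p ℓ (γ ℓ) / (π ℓ (γ ℓ) * F ℓ (γ ℓ)) * ∏_{ℓ : γ ℓ = none} E[1 / F ℓ (I ℓ)]`. -/
theorem ticket_gradient_factorizes
    {m : ℕ} {n : Fin m → ℕ}
    (p : ∀ ℓ, Fin (n ℓ) → ℝ) (π : ∀ ℓ, Fin (n ℓ) → ℝ)
    (hp : ∀ ℓ i, 0 < p ℓ i) (hpsum : ∀ ℓ, ∑ i, p ℓ i = 1) (hπ : ∀ ℓ i, 0 < π ℓ i)
    (c : ∀ ℓ : Fin m, ℝ) (s : ∀ ℓ, Fin (n ℓ) → ℝ)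
    (hc : ∀ ℓ, 0 < c ℓ) (hs : ∀ ℓ i, 0 ≤ s ℓ i)
    (hbudget : ∀ ℓ, c ℓ + ∑ i, s ℓ i = 1)
    (F : ∀ ℓ, Fin (n ℓ) → ℝ) (hF : ∀ ℓ i, F ℓ i = c ℓ + s ℓ i / π ℓ i)
    (x : (∀ ℓ : Fin m, Option (Fin (n ℓ))) → ℝ)
    (hx : ∀ γ, x γ = ∏ ℓ, (γ ℓ).elim (c ℓ) (s ℓ))
    (W : (∀ ℓ : Fin m, Fin (n ℓ)) → ℝ)
    (hW : ∀ I, W I = ∑ γ ∈ univ.filter (fun γ : ∀ ℓ : Fin m, Option (Fin (n ℓ)) =>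
        ∀ ℓ, γ ℓ = none ∨ γ ℓ = some (I ℓ)), x γ / ∏ ℓ, (γ ℓ).elim 1 (π ℓ)) :
    ∀ γ : ∀ ℓ : Fin m, Option (Fin (n ℓ)),
      (∑ I : ∀ ℓ : Fin m, Fin (n ℓ), (∏ ℓ, p ℓ (I ℓ)) *
          (if ∀ ℓ, γ ℓ = none ∨ γ ℓ = some (I ℓ) then
            1 / ((∏ ℓ, (γ ℓ).elim 1 (π ℓ)) * W I) else 0))
        = ∏ ℓ, (γ ℓ).elim (∑ i, p ℓ i * (1 / F ℓ i))
            (fun i => p ℓ i / (π ℓ i * F ℓ i)) := by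
  have hWprod : ∀ I, W I = ∏ ℓ, F ℓ (I ℓ) := by
    intro I
    simp only [hW, hx, ← prod_div_distrib]
    rw [sum_filter_compatible_prod I fun ℓ o => o.elim (c ℓ) (s ℓ) / o.elim 1 (π ℓ)]
    simp [hF]
  intro γ
  have hterm : ∀ I : ∀ ℓ : Fin m, Fin (n ℓ), (∏ ℓ, p ℓ (I ℓ)) *
      (if ∀ ℓ, γ ℓ = none ∨ γ ℓ = some (I ℓ) then
        1 / ((∏ ℓ, (γ ℓ).elim 1 (π ℓ)) * W I) else 0)
      = ∏ ℓ, p ℓ (I ℓ) * (if γ ℓ = none ∨ γ ℓ = some (I ℓ) then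
        1 / ((γ ℓ).elim 1 (π ℓ) * F ℓ (I ℓ)) else 0) := by
    intro I
    rw [prod_mul_distrib]
    congr 1
    split_ifs with h
    · simp only [hWprod, h, if_true, prod_div_distrib, prod_mul_distrib, prod_const_one]
    · push Not at h
      obtain ⟨ℓ, hℓ⟩ := h
      exact (prod_eq_zero (mem_univ ℓ) (if_neg (by tauto))).symm
  simp only [hterm]
  rw [← Fintype.piFinset_univ, ← prod_univ_sum (fun _ => univ) fun ℓ i => p ℓ i *
    (if γ ℓ = none ∨ γ ℓ = some i then 1 / ((γ ℓ).elim 1 (π ℓ) * F ℓ i) else 0)]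
  refine prod_congr rfl fun ℓ _ => ?_
  cases γ ℓ with
  | none => simp
  | some j => simp [div_eq_mul_inv]
end

section
/- Let m_1, m_2 ∈ (−1,1) and define f_1 = m_1(1 − m_2²)/(1 − m_1² m_2²) and f_2 = m_2(1 − m_1²)/(1 − m_1² m_2²). Then |f_1| + |f_2| < 1, the pair (f_1, f_2) satisfies the first-order conditions E[Z_1/(1 + f_1 Z_1 + f_2 Z_2)] = 0 and E[Z_2/(1 + f_1 Z_1 + f_2 Z_2)] = 0, and (f_1, f_2) is the unique maximizer of E[log(1 + g_1 Z_1 + g_2 Z_2)] over all (g_1, g_2) with |g_1| + |g_2| < 1. -/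
open MeasureTheory ProbabilityTheory

/-- The mean of a `{1, -1}`-valued random variable is determined by `P (Z = 1)`. -/
lemma integral_of_ae_eq_one_or_neg_one {Ω : Type*} [MeasurableSpace Ω] (μ : Measure Ω)
    [IsProbabilityMeasure μ] {m : ℝ} (hm : -1 < m) {Z : Ω → ℝ} (hZ : Measurable Z)
    (hval : ∀ᵐ ω ∂μ, Z ω = 1 ∨ Z ω = -1)
    (hp : μ {ω | Z ω = 1} = ENNReal.ofReal ((1 + m) / 2)) :
    Integrable Z μ ∧ ∫ ω, Z ω ∂μ = m := by
  have hS : MeasurableSet {ω | Z ω = 1} := hZ (measurableSet_singleton 1)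
  refine ⟨Integrable.of_bound hZ.aestronglyMeasurable 1 ?_, ?_⟩
  · filter_upwards [hval] with ω h
    rcases h with h | h <;> simp [h]
  have hae : Z =ᵐ[μ] fun ω => {ω | Z ω = 1}.indicator (fun _ => (2 : ℝ)) ω - 1 := by
    filter_upwards [hval] with ω h
    rcases h with h | h <;> norm_num [Set.indicator, h]
  rw [integral_congr_ae hae, integral_sub ((integrable_const _).indicator hS) (integrable_const _),
    integral_indicator_const _ hS, measureReal_def, hp, ENNReal.toReal_ofReal (by linarith)]
  simp

/-- The expectation of a function of two independent `{1, -1}`-valued random variables. -/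
lemma integral_comp_of_indepFun_of_ae_eq_one_or_neg_one {Ω : Type*} [MeasurableSpace Ω]
    (μ : Measure Ω) [IsProbabilityMeasure μ] {m₁ m₂ : ℝ} {Z₁ Z₂ : Ω → ℝ}
    (hval₁ : ∀ᵐ ω ∂μ, Z₁ ω = 1 ∨ Z₁ ω = -1) (hval₂ : ∀ᵐ ω ∂μ, Z₂ ω = 1 ∨ Z₂ ω = -1)
    (hZ₁ : Integrable Z₁ μ) (hZ₂ : Integrable Z₂ μ)
    (hE₁ : ∫ ω, Z₁ ω ∂μ = m₁) (hE₂ : ∫ ω, Z₂ ω ∂μ = m₂)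
    (hindep : IndepFun Z₁ Z₂ μ) (F : ℝ → ℝ → ℝ) :
    ∫ ω, F (Z₁ ω) (Z₂ ω) ∂μ =
      (1 + m₁) * (1 + m₂) / 4 * F 1 1 + (1 + m₁) * (1 - m₂) / 4 * F 1 (-1) +
      (1 - m₁) * (1 + m₂) / 4 * F (-1) 1 + (1 - m₁) * (1 - m₂) / 4 * F (-1) (-1) := by
  have hZ₁₂ : Integrable (fun ω => Z₁ ω * Z₂ ω) μ := hindep.integrable_mul hZ₁ hZ₂
  have hE₁₂ : ∫ ω, Z₁ ω * Z₂ ω ∂μ = m₁ * m₂ := by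
    rw [hindep.integral_fun_mul_eq_mul_integral hZ₁.aestronglyMeasurable
      hZ₂.aestronglyMeasurable, hE₁, hE₂]
  have hae : (fun ω => F (Z₁ ω) (Z₂ ω)) =ᵐ[μ] fun ω =>
      (F 1 1 + F 1 (-1) + F (-1) 1 + F (-1) (-1)) / 4 +
      (F 1 1 + F 1 (-1) - F (-1) 1 - F (-1) (-1)) / 4 * Z₁ ω +
      (F 1 1 - F 1 (-1) + F (-1) 1 - F (-1) (-1)) / 4 * Z₂ ω +
      (F 1 1 - F 1 (-1) - F (-1) 1 + F (-1) (-1)) / 4 * (Z₁ ω * Z₂ ω) := by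
    filter_upwards [hval₁, hval₂] with ω h₁ h₂
    rcases h₁ with h₁ | h₁ <;> rcases h₂ with h₂ | h₂ <;> rw [h₁, h₂] <;> ring
  rw [integral_congr_ae hae, integral_add (by fun_prop) (by fun_prop),
    integral_add (by fun_prop) (by fun_prop), integral_add (by fun_prop) (by fun_prop),
    integral_const_mul, integral_const_mul, integral_const_mul, hE₁, hE₂, hE₁₂,
    integral_const, probReal_univ, one_smul]
  ring

/-- Weighted tangent-line inequality for the logarithm. -/
lemma mul_log_le_mul_log_add {w x y : ℝ} (hw : 0 < w) (hx : 0 < x) (hy : 0 < y) :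
    w * x * Real.log y ≤ w * x * Real.log x + w * (y - x) := by
  have h := Real.log_le_sub_one_of_pos (div_pos hy hx)
  rw [Real.log_div hy.ne' hx.ne'] at h
  have h' := mul_le_mul_of_nonneg_left h (mul_pos hw hx).le
  have e : w * x * (y / x - 1) = w * (y - x) := by field_simp
  linarith

/-- The equality case of the weighted tangent-line inequality for the logarithm. -/
lemma eq_of_mul_log_add_le {w x y : ℝ} (hw : 0 < w) (hx : 0 < x) (hy : 0 < y)
    (h : w * x * Real.log x + w * (y - x) ≤ w * x * Real.log y) : y = x := by
  by_contra hne
  have hlt := Real.log_lt_sub_one_of_pos (div_pos hy hx) (by rwa [ne_eq, div_eq_one_iff_eq hx.ne'])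
  rw [Real.log_div hy.ne' hx.ne'] at hlt
  have h' := mul_lt_mul_of_pos_left hlt (mul_pos hw hx)
  have e : w * x * (y / x - 1) = w * (y - x) := by field_simp
  linarith

lemma abs_add_abs_lt_one_iff {a b : ℝ} :
    |a| + |b| < 1 ↔ 0 < 1 + a + b ∧ 0 < 1 + a - b ∧ 0 < 1 - a + b ∧ 0 < 1 - a - b := by
  constructor
  · intro h
    have := neg_abs_le a
    have := le_abs_self a
    have := neg_abs_le b
    have := le_abs_self b
    refine ⟨?_, ?_, ?_, ?_⟩ <;> linarith
  · rintro ⟨h₁, h₂, h₃, h₄⟩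
    rcases abs_cases a with ⟨ha, _⟩ | ⟨ha, _⟩ <;> rcases abs_cases b with ⟨hb, _⟩ | ⟨hb, _⟩ <;>
      rw [ha, hb] <;> linarith

/-- binary check against Thorp: `Z₁` and `Z₂` are independent random variables
taking values in `{+1, −1}` with `P (Zⱼ = 1) = (1 + mⱼ)/2` and `P (Zⱼ = −1) = (1 − mⱼ)/2`
(so `E[Zⱼ] = mⱼ`) for parameters `m₁, m₂ ∈ (−1, 1)`.  With
`f₁ = m₁ (1 − m₂²) / (1 − m₁² m₂²)` and `f₂ = m₂ (1 − m₁²) / (1 − m₁² m₂²)`, one has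
`|f₁| + |f₂| < 1`, the first-order conditions `E[Z₁ / (1 + f₁ Z₁ + f₂ Z₂)] = 0` and
`E[Z₂ / (1 + f₁ Z₁ + f₂ Z₂)] = 0` hold, and `(f₁, f₂)` is the unique maximizer of
`E[log (1 + g₁ Z₁ + g₂ Z₂)]` over all `(g₁, g₂)` with `|g₁| + |g₂| < 1`. -/
theorem thorp_two_binary_exact
    {Ω : Type*} [MeasurableSpace Ω] (μ : Measure Ω) [IsProbabilityMeasure μ]
    (m₁ m₂ : ℝ) (hm₁ : m₁ ∈ Set.Ioo (-1 : ℝ) 1) (hm₂ : m₂ ∈ Set.Ioo (-1 : ℝ) 1)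
    (Z₁ Z₂ : Ω → ℝ) (hZ₁ : Measurable Z₁) (hZ₂ : Measurable Z₂)
    (hval₁ : ∀ᵐ ω ∂μ, Z₁ ω = 1 ∨ Z₁ ω = -1)
    (hval₂ : ∀ᵐ ω ∂μ, Z₂ ω = 1 ∨ Z₂ ω = -1)
    (hp₁ : μ {ω | Z₁ ω = 1} = ENNReal.ofReal ((1 + m₁) / 2))
    (hp₁' : μ {ω | Z₁ ω = -1} = ENNReal.ofReal ((1 - m₁) / 2))
    (hp₂ : μ {ω | Z₂ ω = 1} = ENNReal.ofReal ((1 + m₂) / 2))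
    (hp₂' : μ {ω | Z₂ ω = -1} = ENNReal.ofReal ((1 - m₂) / 2))
    (hindep : IndepFun Z₁ Z₂ μ)
    (f₁ f₂ : ℝ)
    (hf₁ : f₁ = m₁ * (1 - m₂ ^ 2) / (1 - m₁ ^ 2 * m₂ ^ 2))
    (hf₂ : f₂ = m₂ * (1 - m₁ ^ 2) / (1 - m₁ ^ 2 * m₂ ^ 2)) :
    |f₁| + |f₂| < 1 ∧
    (∫ ω, Z₁ ω / (1 + f₁ * Z₁ ω + f₂ * Z₂ ω) ∂μ) = 0 ∧
    (∫ ω, Z₂ ω / (1 + f₁ * Z₁ ω + f₂ * Z₂ ω) ∂μ) = 0 ∧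
    (∀ g₁ g₂ : ℝ, |g₁| + |g₂| < 1 →
      (∫ ω, Real.log (1 + g₁ * Z₁ ω + g₂ * Z₂ ω) ∂μ) ≤
        ∫ ω, Real.log (1 + f₁ * Z₁ ω + f₂ * Z₂ ω) ∂μ) ∧
    (∀ g₁ g₂ : ℝ, |g₁| + |g₂| < 1 →
      (∫ ω, Real.log (1 + g₁ * Z₁ ω + g₂ * Z₂ ω) ∂μ) =
        (∫ ω, Real.log (1 + f₁ * Z₁ ω + f₂ * Z₂ ω) ∂μ) →
      g₁ = f₁ ∧ g₂ = f₂) := by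
  obtain ⟨hm₁l, hm₁u⟩ := hm₁
  obtain ⟨hm₂l, hm₂u⟩ := hm₂
  obtain ⟨hI₁, hE₁⟩ := integral_of_ae_eq_one_or_neg_one μ hm₁l hZ₁ hval₁ hp₁
  obtain ⟨hI₂, hE₂⟩ := integral_of_ae_eq_one_or_neg_one μ hm₂l hZ₂ hval₂ hp₂
  have hE := integral_comp_of_indepFun_of_ae_eq_one_or_neg_one μ hval₁ hval₂ hI₁ hI₂ hE₁ hE₂ hindep
  have a₁ : 0 < 1 + m₁ := by linarith
  have b₁ : 0 < 1 - m₁ := by linarith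
  have a₂ : 0 < 1 + m₂ := by linarith
  have b₂ : 0 < 1 - m₂ := by linarith
  have hc₁ : 0 < 1 + m₁ * m₂ := by nlinarith [mul_pos a₁ a₂, mul_pos b₁ b₂]
  have hc₂ : 0 < 1 - m₁ * m₂ := by nlinarith [mul_pos a₁ b₂, mul_pos b₁ a₂]
  have hD : 1 - m₁ ^ 2 * m₂ ^ 2 ≠ 0 := by
    have := mul_pos hc₁ hc₂
    nlinarith
  have hp : (1 + m₁) * (1 + m₂) / 4 = (1 + m₁ * m₂) / 4 * (1 + f₁ + f₂) := by
    rw [hf₁, hf₂]; field_simp; ring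
  have hq : (1 + m₁) * (1 - m₂) / 4 = (1 - m₁ * m₂) / 4 * (1 + f₁ - f₂) := by
    rw [hf₁, hf₂]; field_simp; ring
  have hr : (1 - m₁) * (1 + m₂) / 4 = (1 - m₁ * m₂) / 4 * (1 - f₁ + f₂) := by
    rw [hf₁, hf₂]; field_simp; ring
  have hs : (1 - m₁) * (1 - m₂) / 4 = (1 + m₁ * m₂) / 4 * (1 - f₁ - f₂) := by
    rw [hf₁, hf₂]; field_simp; ring
  have hw₁ : 0 < (1 + m₁ * m₂) / 4 := by positivity
  have hw₂ : 0 < (1 - m₁ * m₂) / 4 := by positivity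
  have hX₁ : 0 < 1 + f₁ + f₂ := (mul_pos_iff_of_pos_left hw₁).1 (hp ▸ by positivity)
  have hX₂ : 0 < 1 + f₁ - f₂ := (mul_pos_iff_of_pos_left hw₂).1 (hq ▸ by positivity)
  have hX₃ : 0 < 1 - f₁ + f₂ := (mul_pos_iff_of_pos_left hw₂).1 (hr ▸ by positivity)
  have hX₄ : 0 < 1 - f₁ - f₂ := (mul_pos_iff_of_pos_left hw₁).1 (hs ▸ by positivity)
  have hlog (g₁ g₂ : ℝ) : ∫ ω, Real.log (1 + g₁ * Z₁ ω + g₂ * Z₂ ω) ∂μ =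
      (1 + m₁ * m₂) / 4 * (1 + f₁ + f₂) * Real.log (1 + g₁ + g₂) +
      (1 - m₁ * m₂) / 4 * (1 + f₁ - f₂) * Real.log (1 + g₁ - g₂) +
      (1 - m₁ * m₂) / 4 * (1 - f₁ + f₂) * Real.log (1 - g₁ + g₂) +
      (1 + m₁ * m₂) / 4 * (1 - f₁ - f₂) * Real.log (1 - g₁ - g₂) := by
    rw [hE fun x y => Real.log (1 + g₁ * x + g₂ * y), hp, hq, hr, hs]
    simp only [mul_one, mul_neg, ← sub_eq_add_neg]
  refine ⟨abs_add_abs_lt_one_iff.2 ⟨hX₁, hX₂, hX₃, hX₄⟩, ?_, ?_, fun g₁ g₂ hg => ?_,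
    fun g₁ g₂ hg heq => ?_⟩
  · rw [hE fun x y => x / (1 + f₁ * x + f₂ * y), hp, hq, hr, hs]
    simp only [mul_one, mul_neg, ← sub_eq_add_neg]
    field_simp
    ring
  · rw [hE fun x y => y / (1 + f₁ * x + f₂ * y), hp, hq, hr, hs]
    simp only [mul_one, mul_neg, ← sub_eq_add_neg]
    field_simp
    ring
  · obtain ⟨hY₁, hY₂, hY₃, hY₄⟩ := abs_add_abs_lt_one_iff.1 hg
    rw [hlog, hlog]
    linarith [mul_log_le_mul_log_add hw₁ hX₁ hY₁, mul_log_le_mul_log_add hw₂ hX₂ hY₂,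
      mul_log_le_mul_log_add hw₂ hX₃ hY₃, mul_log_le_mul_log_add hw₁ hX₄ hY₄]
  · obtain ⟨hY₁, hY₂, hY₃, hY₄⟩ := abs_add_abs_lt_one_iff.1 hg
    rw [hlog, hlog] at heq
    have h₁ := mul_log_le_mul_log_add hw₁ hX₁ hY₁
    have h₂ := mul_log_le_mul_log_add hw₂ hX₂ hY₂
    have h₃ := mul_log_le_mul_log_add hw₂ hX₃ hY₃
    have h₄ := mul_log_le_mul_log_add hw₁ hX₄ hY₄
    have e₁ := eq_of_mul_log_add_le hw₁ hX₁ hY₁ (by linarith)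
    have e₂ := eq_of_mul_log_add_le hw₂ hX₂ hY₂ (by linarith)
    constructor <;> linarith
end
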